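/- Let Ω be a nonempty connected open subset of ℂ^N and let (f_k)_{k ∈ ℕ} be a sequence of holomorphic (complex analytic) functions on Ω. Suppose that for every z ∈ Ω there exists m ∈ ℕ such that f_k(z) = 0 for all k ≥ m. Then there exists m₀ ∈ ℕ such that f_k vanishes identically on Ω for all k ≥ m₀. -/

import Mathlib

open scoped Topology

/-- Let `Ω` be a nonempty connected open subset of `ℂ^N` and `(f_k)` a
sequence of holomorphic functions on `Ω`.  If for every `z ∈ Ω` there is `m` with `f_k z = 0`
for all `k ≥ m`, then there is `m₀` such that `f_k` vanishes identically on `Ω` for all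
`k ≥ m₀`. -/
theorem statement_11 (N : ℕ) (Ω : Set (Fin N → ℂ)) (hopen : IsOpen Ω) (hconn : IsConnected Ω)
    (f : ℕ → (Fin N → ℂ) → ℂ) (hf : ∀ k, AnalyticOnNhd ℂ (f k) Ω)
    (h : ∀ z ∈ Ω, ∃ m : ℕ, ∀ k ≥ m, f k z = 0) :
    ∃ m₀ : ℕ, ∀ k ≥ m₀, ∀ z ∈ Ω, f k z = 0 := by
  have : Nonempty Ω := hconn.nonempty.to_subtype
  have : BaireSpace Ω := hopen.baireSpace
  have hclosed (m : ℕ) : IsClosed {z : Ω | ∀ k ≥ m, f k z = 0} := by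
    simp only [Set.ofPred_forall]
    exact isClosed_iInter fun k ↦ isClosed_iInter fun _ ↦
      isClosed_eq (hf k).continuousOn.domRestrict continuous_const
  have hunion : ⋃ m, {z : Ω | ∀ k ≥ m, f k z = 0} = Set.univ :=
    Set.iUnion_eq_univ_iff.2 fun z ↦ h z z.2
  obtain ⟨m, z, hz⟩ := nonempty_interior_of_iUnion_of_closed hclosed hunion
  refine ⟨m, fun k hk ↦ ?_⟩
  refine (hf k).eqOn_zero_of_preconnected_of_eventuallyEq_zero hconn.isPreconnected z.2 ?_
  have hev : ∀ᶠ w : Ω in 𝓝 z, f k w = 0 :=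
    Filter.mem_of_superset (mem_interior_iff_mem_nhds.1 hz) fun w hw ↦ hw k hk
  rw [← hopen.nhdsWithin_eq z.2]
  exact (eventually_nhds_subtype_iff Ω z (fun w ↦ f k w = 0)).1 hev
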